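/- arXiv:1912.12150 — 6 statements merged into one kernel-verified Lean document; each statement's English description precedes it below -/
import Mathlib

section
/- Let n ≥ 4 be an integer and let A and B be real n×n symmetric matrices with zero diagonal. For i ≠ j define C^A_{ij} = A_{ij} − A_{i·}/(n−2) − A_{·j}/(n−2) + A_{··}/((n−1)(n−2)) and C^A_{ii} = 0, and define C^B analogously from B. Then (1/(n(n−3))) Σ_{i,j=1}^n C^A_{ij} C^B_{ij} = T1/(n(n−3)) − 2·T2/(n(n−2)(n−3)) + T3/(n(n−1)(n−2)(n−3)), where T1 = Σ_{i,j=1}^n A_{ij} B_{ij}, T2 = Σ_{i=1}^n A_{i·} B_{i·}, and T3 = A_{··} B_{··}. -/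
open Finset

/-- The identity underlying the O(n log n) computation of the
bias-corrected sample distance covariance. -/
theorem unbiased_dcov_identity (n : ℕ) (hn : 4 ≤ n)
    (A B : Matrix (Fin n) (Fin n) ℝ) (hA : A.IsSymm) (hB : B.IsSymm)
    (hAdiag : ∀ i, A i i = 0) (hBdiag : ∀ i, B i i = 0)
    (CA CB : Matrix (Fin n) (Fin n) ℝ)
    (hCA : ∀ i j, CA i j = if i = j then 0 else
      A i j - (∑ t, A i t) / ((n : ℝ) - 2) - (∑ s, A s j) / ((n : ℝ) - 2)
        + (∑ s, ∑ t, A s t) / (((n : ℝ) - 1) * ((n : ℝ) - 2)))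
    (hCB : ∀ i j, CB i j = if i = j then 0 else
      B i j - (∑ t, B i t) / ((n : ℝ) - 2) - (∑ s, B s j) / ((n : ℝ) - 2)
        + (∑ s, ∑ t, B s t) / (((n : ℝ) - 1) * ((n : ℝ) - 2))) :
    (1 / ((n : ℝ) * ((n : ℝ) - 3))) * ∑ i, ∑ j, CA i j * CB i j =
      (∑ i, ∑ j, A i j * B i j) / ((n : ℝ) * ((n : ℝ) - 3))
      - 2 * (∑ i, (∑ j, A i j) * (∑ j, B i j)) /
          ((n : ℝ) * ((n : ℝ) - 2) * ((n : ℝ) - 3))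
      + ((∑ i, ∑ j, A i j) * (∑ i, ∑ j, B i j)) /
          ((n : ℝ) * ((n : ℝ) - 1) * ((n : ℝ) - 2) * ((n : ℝ) - 3)) := by
  have h4 : (4 : ℝ) ≤ n := by exact_mod_cast hn
  have n0 : (n : ℝ) ≠ 0 := by linarith
  have n1 : (n : ℝ) - 1 ≠ 0 := by intro h; linarith
  have n2 : (n : ℝ) - 2 ≠ 0 := by intro h; linarith
  have n3 : (n : ℝ) - 3 ≠ 0 := by intro h; linarith
  have colA : ∀ j, ∑ s, A s j = ∑ t, A j t := fun j =>
    Finset.sum_congr rfl fun s _ => hA.apply j s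
  have colB : ∀ j, ∑ s, B s j = ∑ t, B j t := fun j =>
    Finset.sum_congr rfl fun s _ => hB.apply j s
  simp only [colA] at hCA
  simp only [colB] at hCB
  obtain ⟨a, ha⟩ : ∃ a : Fin n → ℝ, ∀ i, ∑ t, A i t = a i := ⟨_, fun _ => rfl⟩
  obtain ⟨b, hb⟩ : ∃ b : Fin n → ℝ, ∀ i, ∑ t, B i t = b i := ⟨_, fun _ => rfl⟩
  simp only [ha] at hCA colA
  simp only [hb] at hCB colB
  simp only [ha, hb]
  obtain ⟨S, hS⟩ : ∃ S, ∑ i, a i = S := ⟨_, rfl⟩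
  obtain ⟨R, hR⟩ : ∃ R, ∑ i, b i = R := ⟨_, rfl⟩
  simp only [hS] at hCA
  simp only [hR] at hCB
  simp only [hS, hR]
  -- rows and columns of `CA` sum to zero
  have row : ∀ i, ∑ j, CA i j = 0 := by
    intro i
    have e : ∀ j, CA i j = (A i j - a i / ((n : ℝ) - 2) - a j / ((n : ℝ) - 2)
        + S / (((n : ℝ) - 1) * ((n : ℝ) - 2)))
        - if i = j then (- a i / ((n : ℝ) - 2) - a i / ((n : ℝ) - 2)
        + S / (((n : ℝ) - 1) * ((n : ℝ) - 2))) else 0 := by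
      intro j
      rw [hCA]
      split_ifs with h
      · subst h
        rw [hAdiag]; ring
      · ring
    simp only [e, Finset.sum_sub_distrib, Finset.sum_add_distrib, ← Finset.sum_div, ha, hS,
      Finset.sum_const, Finset.card_univ, Fintype.card_fin, nsmul_eq_mul, Finset.sum_ite_eq,
      Finset.mem_univ, if_true]
    field_simp
    ring
  have symm : ∀ i j, CA i j = CA j i := by
    intro i j
    rw [hCA, hCA, hA.apply j i]
    by_cases h : i = j
    · simp [h]
    · rw [if_neg h, if_neg (Ne.symm h)]; ring
  have col : ∀ j, ∑ i, CA i j = 0 := fun j => by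
    rw [← row j]; exact Finset.sum_congr rfl fun i _ => symm i j
  have e1 : ∀ i j, CA i j * CB i j = CA i j * B i j - CA i j * (b i / ((n : ℝ) - 2))
      - CA i j * (b j / ((n : ℝ) - 2)) + CA i j * (R / (((n : ℝ) - 1) * ((n : ℝ) - 2))) := by
    intro i j
    by_cases h : i = j
    · simp [hCA, h]
    · rw [hCB, if_neg h]; ring
  have e2 : ∀ i j, CA i j * B i j = A i j * B i j - a i * B i j / ((n : ℝ) - 2)
      - a j * B i j / ((n : ℝ) - 2) + S * B i j / (((n : ℝ) - 1) * ((n : ℝ) - 2)) := by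
    intro i j
    by_cases h : i = j
    · simp [h, hBdiag]
    · rw [hCA, if_neg h]; ring
  have z : ∑ i, ∑ j, CA i j * (b j / ((n : ℝ) - 2)) = 0 := by
    rw [Finset.sum_comm]
    simp only [← Finset.sum_mul, col, zero_mul, Finset.sum_const_zero]
  have w : ∑ i, ∑ j, a j * B i j = ∑ i, a i * b i := by
    rw [Finset.sum_comm]
    simp only [← Finset.mul_sum, colB]
  have key : ∑ i, ∑ j, CA i j * CB i j = ∑ i, ∑ j, CA i j * B i j := by
    simp only [e1, Finset.sum_sub_distrib, Finset.sum_add_distrib, z]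
    simp only [← Finset.sum_mul, row, zero_mul, Finset.sum_const_zero, sub_zero, add_zero]
  rw [key]
  simp only [e2, Finset.sum_sub_distrib, Finset.sum_add_distrib, ← Finset.sum_div, w]
  simp only [← Finset.mul_sum, hb, hR]
  field_simp
  ring
end

section
/- Let n ≥ 1 and m ≥ 1 be integers, let D be a real n×n matrix such that the set of rows {D_i : i = 1,…,n} contains at most m distinct vectors, and let H = I_n − (1/n)J_n be the centering matrix. Then rank(H·D) ≤ m − 1. -/
/-- If the rows of `D` take at most `m` distinct values, then the
centered matrix `H * D`, with `H = I − (1/n)J` the centering matrix, has rank at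
most `m − 1`. -/
theorem rank_centering_mul_le (n m : ℕ) (hn : 1 ≤ n) (hm : 1 ≤ m)
    (D : Matrix (Fin n) (Fin n) ℝ)
    (hrows : (Set.range fun i => D i).ncard ≤ m)
    (H : Matrix (Fin n) (Fin n) ℝ)
    (hH : H = 1 - ((n : ℝ)⁻¹) • (Matrix.of fun _ _ => (1 : ℝ))) :
    (H * D).rank ≤ m - 1 := by
  classical
  have hn0 : (n : ℝ) ≠ 0 := by
    have : n ≠ 0 := by omega
    exact_mod_cast this
  let i0 : Fin n := ⟨0, hn⟩
  let E : Matrix (Fin n) (Fin n) ℝ := Matrix.of fun i j => D i j - D i0 j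
  have hsum : ∀ i, ∑ k, H i k = 0 := by
    intro i
    subst hH
    simp [Matrix.sub_apply, Finset.sum_sub_distrib, Matrix.one_apply, hn0]
  have hHE : H * D = H * E := by
    ext i j
    simp only [Matrix.mul_apply, E, Matrix.of_apply, mul_sub, Finset.sum_sub_distrib]
    rw [← Finset.sum_mul, hsum]
    simp
  rw [hHE]
  refine (Matrix.rank_mul_le_right H E).trans ?_
  rw [Matrix.rank_eq_finrank_span_row]
  let S : Finset (Fin n → ℝ) := Finset.univ.image fun i => D i
  have hS : S.card ≤ m := by
    rw [← Set.ncard_coe_finset]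
    simpa [S] using hrows
  let T : Finset (Fin n → ℝ) := (S.erase (D i0)).image fun v => v - D i0
  have hT : T.card ≤ m - 1 := by
    refine Finset.card_image_le.trans ?_
    rw [Finset.card_erase_of_mem (Finset.mem_image_of_mem _ (Finset.mem_univ i0))]
    exact Nat.sub_le_sub_right hS 1
  have hle : Submodule.span ℝ (Set.range E.row) ≤ Submodule.span ℝ (T : Set (Fin n → ℝ)) := by
    rw [Submodule.span_le]
    rintro _ ⟨i, rfl⟩
    have hr : E.row i = D i - D i0 := rfl
    rw [hr]
    by_cases h : D i = D i0
    · rw [h, sub_self]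
      exact Submodule.zero_mem _
    · apply Submodule.subset_span
      exact Finset.mem_coe.2 (Finset.mem_image.2 ⟨D i, Finset.mem_erase.2
        ⟨h, Finset.mem_image_of_mem _ (Finset.mem_univ i)⟩, rfl⟩)
  exact (Submodule.finrank_mono hle).trans ((finrank_span_finset_le_card T).trans hT)
end

section
/- Let n ≥ 1 and m ≥ 1 be integers, let D be a real n×n matrix such that the set of rows {D_i : i = 1,…,n} contains at most m distinct vectors, and let H = I_n − (1/n)J_n be the centering matrix. Then rank(H·D·H) ≤ m − 1. In particular, when D is symmetric, the matrix H·D·H has at most m − 1 nonzero eigenvalues. -/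
/-- If the rows of `D` take at most `m` distinct values, then the
doubly centered matrix `H * D * H` has rank at most `m − 1`; in particular, when
`D` is symmetric, `H * D * H` has at most `m − 1` nonzero eigenvalues. -/
theorem rank_centering_conj_le (n m : ℕ) (hn : 1 ≤ n) (hm : 1 ≤ m)
    (D : Matrix (Fin n) (Fin n) ℝ)
    (hrows : (Set.range fun i => D i).ncard ≤ m)
    (H : Matrix (Fin n) (Fin n) ℝ)
    (hH : H = 1 - ((n : ℝ)⁻¹) • (Matrix.of fun _ _ => (1 : ℝ))) :
    (H * D * H).rank ≤ m - 1 ∧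
      (D.IsSymm → ∀ hHerm : (H * D * H).IsHermitian,
        {i : Fin n | hHerm.eigenvalues i ≠ 0}.ncard ≤ m - 1) := by
  have key : (H * D * H).rank ≤ m - 1 := by
    let z : Fin n := ⟨0, hn⟩
    let R : Matrix (Fin n) (Fin n) ℝ := Matrix.of fun _ j => D z j
    have hn0 : (n : ℝ) ≠ 0 := by
      have : n ≠ 0 := by omega
      exact_mod_cast this
    have hR : H * R = 0 := by
      ext i j
      rw [hH, Matrix.sub_mul, Matrix.one_mul, Matrix.smul_mul]
      simp [R, Matrix.mul_apply, hn0]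
    have hHD : H * D = H * (D - R) := by
      rw [Matrix.mul_sub, hR, sub_zero]
    have h1 : (H * D * H).rank ≤ (D - R).rank := by
      refine (Matrix.rank_mul_le_left _ _).trans ?_
      rw [hHD]
      exact Matrix.rank_mul_le_right _ _
    refine h1.trans ?_
    classical
    let S : Finset (Fin n → ℝ) := Finset.univ.image fun i => D i
    have hS : S.card ≤ m := by
      rw [← Set.ncard_coe_finset]
      simpa [S] using hrows
    let T : Finset (Fin n → ℝ) := (S.erase (D z)).image fun v => v - D z
    have hz : D z ∈ S := Finset.mem_image_of_mem _ (Finset.mem_univ z)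
    have hT : T.card ≤ m - 1 := by
      refine Finset.card_image_le.trans ?_
      rw [Finset.card_erase_of_mem hz]
      omega
    refine le_trans ?_ hT
    rw [Matrix.rank_eq_finrank_span_row]
    refine le_trans ?_ (finrank_span_finset_le_card (R := ℝ) T)
    apply Submodule.finrank_mono
    rw [Submodule.span_le]
    rintro _ ⟨i, rfl⟩
    have hrow : (D - R).row i = D i - D z := by
      ext j
      simp [R, Matrix.row]
    rw [hrow]
    by_cases h : D i = D z
    · rw [h, sub_self]
      exact Submodule.zero_mem _
    · apply Submodule.subset_span
      exact Finset.mem_coe.2 (Finset.mem_image_of_mem (fun v => v - D z)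
        (Finset.mem_erase.2 ⟨h, Finset.mem_image_of_mem _ (Finset.mem_univ i)⟩))
  refine ⟨key, fun _ hHerm => ?_⟩
  have h := hHerm.rank_eq_card_non_zero_eigs
  rw [h] at key
  rw [← Nat.card_coe_set_eq, Nat.card_eq_fintype_card]
  exact key
end

section
/- Let U and V be independent real-valued random variables on a probability space, each having probability density f_U, where f_U(t) = (1/√(2π))·(t+1)^{−1/2}·e^{−(t+1)/2} for t > −1 and f_U(t) = 0 for t ≤ −1. Let w ∈ (0, 1/√2]. Then the random variable w·U + √(1−w²)·V has a probability density h, and there exist a constant C > 0 and x₀ ∈ ℝ such that h(x) ≤ C·(1+x)·e^{−x/(2√(1−w²))} for almost every x ≥ x₀. -/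
open MeasureTheory ProbabilityTheory

/-- The density of the centered chi-square distribution `χ²₁ − 1`. -/
noncomputable def centeredChiSqPDF (t : ℝ) : ℝ :=
  if -1 < t then
    (Real.sqrt (2 * Real.pi))⁻¹ * (t + 1) ^ (-(1 : ℝ) / 2) * Real.exp (-(t + 1) / 2)
  else 0


lemma aux_meas : Measurable centeredChiSqPDF := by
  unfold centeredChiSqPDF
  refine Measurable.ite measurableSet_Ioi ?_ measurable_const
  fun_prop

lemma aux_nonneg (t : ℝ) : 0 ≤ centeredChiSqPDF t := by
  unfold centeredChiSqPDF
  split_ifs with h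
  · have : 0 < t + 1 := by linarith
    positivity
  · exact le_rfl

/-- affine change of variables -/
lemma aux_affine (b c : ℝ) (hb : 0 < b) (G : ℝ → ENNReal) (hG : Measurable G) :
    ∫⁻ v, G (b * v + c) = ENNReal.ofReal b⁻¹ * ∫⁻ x, G x := by
  have h1 : ∫⁻ v, G (b * v + c) = ∫⁻ y, G (y + c) ∂(Measure.map (b * ·) volume) := by
    rw [lintegral_map (by fun_prop) (by fun_prop)]
  rw [h1, Real.map_volume_mul_left hb.ne', lintegral_smul_measure,
    lintegral_add_right_eq_self (fun y => G y) c, abs_of_pos (inv_pos.2 hb), smul_eq_mul]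

/-- the density -/
noncomputable def auxH (a b : ℝ) (x : ℝ) : ENNReal :=
  ENNReal.ofReal b⁻¹ * ∫⁻ u, ENNReal.ofReal (centeredChiSqPDF u) *
    ENNReal.ofReal (centeredChiSqPDF ((x - a * u) / b))

lemma auxH_meas (a b : ℝ) : Measurable (auxH a b) := by
  unfold auxH
  have := aux_meas
  refine Measurable.const_mul ?_ _
  refine Measurable.lintegral_prod_right' (f := fun p : ℝ × ℝ =>
    ENNReal.ofReal (centeredChiSqPDF p.2) *
    ENNReal.ofReal (centeredChiSqPDF ((p.1 - a * p.2) / b))) ?_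
  fun_prop

lemma aux_map {Ω : Type*} [MeasureSpace Ω] [IsProbabilityMeasure (ℙ : Measure Ω)]
    (U V : Ω → ℝ) (hUm : Measurable U) (hVm : Measurable V)
    (hindep : IndepFun U V ℙ)
    (hU : Measure.map U ℙ =
      volume.withDensity fun t => ENNReal.ofReal (centeredChiSqPDF t))
    (hV : Measure.map V ℙ =
      volume.withDensity fun t => ENNReal.ofReal (centeredChiSqPDF t))
    (a b : ℝ) (hb : 0 < b) :
    Measure.map (fun ω => a * U ω + b * V ω) ℙ = volume.withDensity (auxH a b) := by
  have hm := aux_meas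
  have hprod := (indepFun_iff_map_prod_eq_prod_map_map hUm.aemeasurable hVm.aemeasurable).1 hindep
  have hcomp : Measure.map (fun ω => a * U ω + b * V ω) ℙ =
      Measure.map (fun p : ℝ × ℝ => a * p.1 + b * p.2) (Measure.map (fun ω => (U ω, V ω)) ℙ) := by
    rw [Measure.map_map (by fun_prop) (by fun_prop)]; rfl
  have : IsProbabilityMeasure (Measure.map V ℙ) := Measure.isProbabilityMeasure_map hVm.aemeasurable
  ext s hs
  rw [hcomp, hprod, ← lintegral_indicator_one hs, lintegral_map (by measurability) (by fun_prop),
    lintegral_prod _ (by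
      apply Measurable.aemeasurable
      exact (measurable_one.indicator hs).comp (by fun_prop)), hU, hV]
  have hi : Measurable (s.indicator (1 : ℝ → ENNReal)) := measurable_one.indicator hs
  have h1 : ∀ u : ℝ, ∫⁻ v, s.indicator (1 : ℝ → ENNReal) (a * u + b * v)
      ∂(volume.withDensity fun t => ENNReal.ofReal (centeredChiSqPDF t)) =
      ENNReal.ofReal b⁻¹ * ∫⁻ x, ENNReal.ofReal (centeredChiSqPDF ((x - a * u) / b)) *
        s.indicator (1 : ℝ → ENNReal) x := by
    intro u
    rw [lintegral_withDensity_eq_lintegral_mul _ (by fun_prop) (by fun_prop),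
      ← aux_affine b (a * u) hb _ (by fun_prop)]
    refine lintegral_congr fun v => ?_
    have : (b * v + a * u - a * u) / b = v := by field_simp; ring
    simp only [Pi.mul_apply, this, add_comm (a * u)]
  simp only [h1]
  rw [lintegral_withDensity_eq_lintegral_mul _ (by fun_prop) (by
    refine Measurable.const_mul ?_ _
    refine Measurable.lintegral_prod_right' (f := fun p : ℝ × ℝ =>
      ENNReal.ofReal (centeredChiSqPDF ((p.2 - a * p.1) / b)) *
        s.indicator (1 : ℝ → ENNReal) p.2) ?_
    fun_prop)]
  rw [withDensity_apply _ hs, ← lintegral_indicator hs]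
  have h2 : ∀ x, s.indicator (auxH a b) x = ∫⁻ u, ENNReal.ofReal b⁻¹ *
      (ENNReal.ofReal (centeredChiSqPDF u) *
       ENNReal.ofReal (centeredChiSqPDF ((x - a * u) / b)) * s.indicator (1 : ℝ → ENNReal) x) := by
    intro x
    rw [lintegral_const_mul _ (by fun_prop), lintegral_mul_const _ (by fun_prop)]
    by_cases hx : x ∈ s <;> simp [hx, auxH]
  simp only [h2]
  rw [lintegral_lintegral_swap (by
    apply Measurable.aemeasurable
    simp only [Function.uncurry_def]
    fun_prop)]
  refine lintegral_congr fun u => ?_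
  simp only [Pi.mul_apply]
  rw [lintegral_const_mul _ (by fun_prop), mul_left_comm, ← lintegral_const_mul _ (by fun_prop)]
  simp only [mul_assoc]

/-- truncated inverse square root -/
noncomputable def auxg (c t : ℝ) : ENNReal :=
  (Set.Ioc 0 c).indicator (fun t => ENNReal.ofReal (t ^ (-(1 : ℝ) / 2))) t

lemma auxg_meas (c : ℝ) : Measurable (auxg c) := by
  unfold auxg
  exact Measurable.indicator (by fun_prop) measurableSet_Ioc

lemma auxg_int (c : ℝ) (hc : 1 ≤ c) : ∫⁻ t, auxg c t ≤ ENNReal.ofReal (2 * c) := by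
  unfold auxg
  rw [lintegral_indicator measurableSet_Ioc]
  have hI : IntervalIntegrable (fun t : ℝ => t ^ (-(1 : ℝ) / 2)) volume 0 c :=
    intervalIntegral.intervalIntegrable_rpow' (by norm_num)
  rw [intervalIntegrable_iff_integrableOn_Ioc_of_le (by linarith)] at hI
  rw [← ofReal_integral_eq_lintegral_ofReal hI (by
    filter_upwards [ae_restrict_mem measurableSet_Ioc] with t ht
    exact Real.rpow_nonneg ht.1.le _)]
  apply ENNReal.ofReal_le_ofReal
  rw [← intervalIntegral.integral_of_le (by linarith), integral_rpow (by left; norm_num)]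
  have h1 : (-(1 : ℝ) / 2 + 1) = 1 / 2 := by norm_num
  rw [h1, Real.zero_rpow (by norm_num)]
  have : c ^ (1 / 2 : ℝ) ≤ c ^ (1 : ℝ) := Real.rpow_le_rpow_of_exponent_le hc (by norm_num)
  rw [Real.rpow_one] at this
  linarith

/-- pointwise bound -/
lemma aux_pt (a b : ℝ) (ha : 0 < a) (hab : a ≤ b) (x : ℝ) (hx : 0 ≤ x) (u : ℝ) :
    ENNReal.ofReal (centeredChiSqPDF u) * ENNReal.ofReal (centeredChiSqPDF ((x - a * u) / b)) ≤
    ENNReal.ofReal (2 * (a / b) ^ (-(1 : ℝ) / 2) * Real.exp (-x / (2 * b))) *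
      (auxg ((x + a + b) / a) (u + 1) + auxg ((x + a + b) / a) ((x + a + b) / a - 1 - u)) := by
  have hb : 0 < b := ha.trans_le hab
  set c := (x + a + b) / a with hc
  have hc1 : 1 ≤ c := by rw [hc, le_div_iff₀ ha]; linarith
  have hv : (x - a * u) / b + 1 = (a / b) * (c - 1 - u) := by rw [hc]; field_simp; ring
  by_cases h1 : -1 < u
  swap
  · simp [centeredChiSqPDF, h1]
  by_cases h2 : -1 < (x - a * u) / b
  swap
  · simp [centeredChiSqPDF, h2]
  have hs : 0 < u + 1 := by linarith
  have hr : 0 < c - 1 - u := by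
    have : 0 < (a / b) * (c - 1 - u) := by rw [← hv]; linarith
    exact (pos_iff_pos_of_mul_pos this).1 (by positivity)
  have hg1 : auxg c (u + 1) = ENNReal.ofReal ((u + 1) ^ (-(1 : ℝ) / 2)) := by
    unfold auxg; rw [Set.indicator_of_mem]; exact ⟨hs, by linarith⟩
  have hg2 : auxg c (c - 1 - u) = ENNReal.ofReal ((c - 1 - u) ^ (-(1 : ℝ) / 2)) := by
    unfold auxg; rw [Set.indicator_of_mem]; exact ⟨hr, by linarith⟩
  rw [hg1, hg2, ← ENNReal.ofReal_mul (aux_nonneg _), ← ENNReal.ofReal_add (by positivity)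
    (by positivity), ← ENNReal.ofReal_mul (by positivity)]
  apply ENNReal.ofReal_le_ofReal
  unfold centeredChiSqPDF
  rw [if_pos h1, if_pos h2, hv, Real.mul_rpow (by positivity) hr.le]
  set S := (u + 1) ^ (-(1 : ℝ) / 2) with hS
  set R := (c - 1 - u) ^ (-(1 : ℝ) / 2) with hR
  set A := (a / b) ^ (-(1 : ℝ) / 2) with hA
  have hS0 : 0 < S := by positivity
  have hR0 : 0 < R := by positivity
  have hA0 : 0 < A := by positivity
  have hq : (Real.sqrt (2 * Real.pi))⁻¹ ≤ 1 := by
    apply inv_le_one_of_one_le₀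
    rw [Real.one_le_sqrt]; linarith [Real.pi_gt_three]
  have hq0 : 0 < (Real.sqrt (2 * Real.pi))⁻¹ := by positivity
  have hexp : Real.exp (-(u + 1) / 2) * Real.exp (-(a / b * (c - 1 - u)) / 2)
      ≤ Real.exp (-x / (2 * b)) := by
    rw [← Real.exp_add]
    apply Real.exp_le_exp.2
    rw [← hv]
    have e : -x / (2 * b) - (-(u + 1) / 2 + -((x - a * u) / b + 1) / 2)
      = ((b - a) * (u + 1) + a + b) / (2 * b) := by field_simp; ring
    have : 0 ≤ ((b - a) * (u + 1) + a + b) / (2 * b) := by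
      have : 0 ≤ (b - a) * (u + 1) := mul_nonneg (by linarith) hs.le
      positivity
    linarith
  have hhalf : ∀ y : ℝ, 1 / 2 ≤ y → y ^ (-(1 : ℝ) / 2) ≤ 2 := by
    intro y hy
    have h3 : y ^ (-(1 : ℝ) / 2) ≤ (1 / 2 : ℝ) ^ (-(1 : ℝ) / 2) :=
      Real.rpow_le_rpow_of_nonpos (by norm_num) hy (by norm_num)
    have h4 : (1 / 2 : ℝ) ^ (-(1 : ℝ) / 2) ≤ (1 / 2 : ℝ) ^ (-1 : ℝ) :=
      Real.rpow_le_rpow_of_exponent_ge (by norm_num) (by norm_num) (by norm_num)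
    rw [Real.rpow_neg_one] at h4
    norm_num at h4 h3 ⊢
    linarith
  have hSR : S * R ≤ 2 * (S + R) := by
    rcases le_total (1 / 2) (u + 1) with h | h
    · have := hhalf _ h
      nlinarith
    · have := hhalf (c - 1 - u) (by linarith)
      nlinarith
  calc _ = ((Real.sqrt (2 * Real.pi))⁻¹ * (Real.sqrt (2 * Real.pi))⁻¹) * (A * (S * R)) *
        (Real.exp (-(u + 1) / 2) * Real.exp (-(a / b * (c - 1 - u)) / 2)) := by ring
    _ ≤ (1 * 1) * (A * (2 * (S + R))) * Real.exp (-x / (2 * b)) := by gcongr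
    _ = _ := by ring

lemma aux_bound (a b : ℝ) (ha : 0 < a) (hab : a ≤ b) (x : ℝ) (hx : 0 ≤ x) :
    auxH a b x ≤ ENNReal.ofReal ((b⁻¹ * (2 * (a / b) ^ (-(1 : ℝ) / 2)) * 4 * ((1 + a + b) / a))
      * (1 + x) * Real.exp (-x / (2 * b))) := by
  have hb : 0 < b := ha.trans_le hab
  have hc1 : 1 ≤ (x + a + b) / a := by rw [le_div_iff₀ ha]; linarith
  set c := (x + a + b) / a with hc
  have hcb : c ≤ (1 + a + b) / a * (1 + x) := by
    rw [hc, div_mul_eq_mul_div]; gcongr; nlinarith [mul_nonneg ha.le hx, mul_nonneg hb.le hx]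
  have hgm := auxg_meas c
  calc auxH a b x ≤ ENNReal.ofReal b⁻¹ * ∫⁻ u,
        ENNReal.ofReal (2 * (a / b) ^ (-(1 : ℝ) / 2) * Real.exp (-x / (2 * b))) *
          (auxg c (u + 1) + auxg c (c - 1 - u)) := by
        unfold auxH
        exact mul_le_mul_right (lintegral_mono fun u => aux_pt a b ha hab x hx u) _
    _ = ENNReal.ofReal b⁻¹ * (ENNReal.ofReal (2 * (a / b) ^ (-(1 : ℝ) / 2) *
          Real.exp (-x / (2 * b))) * ((∫⁻ t, auxg c t) + ∫⁻ t, auxg c t)) := by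
        rw [lintegral_const_mul _ (by fun_prop), lintegral_add_left (by fun_prop),
          lintegral_add_right_eq_self (auxg c) 1, lintegral_sub_left_eq_self (auxg c) (c - 1)]
    _ ≤ ENNReal.ofReal b⁻¹ * (ENNReal.ofReal (2 * (a / b) ^ (-(1 : ℝ) / 2) *
          Real.exp (-x / (2 * b))) * (ENNReal.ofReal (2 * c) + ENNReal.ofReal (2 * c))) := by
        gcongr <;> exact auxg_int c hc1
    _ = ENNReal.ofReal (b⁻¹ * ((2 * (a / b) ^ (-(1 : ℝ) / 2) *
          Real.exp (-x / (2 * b))) * (2 * c + 2 * c))) := by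
        rw [← ENNReal.ofReal_add (by positivity) (by positivity),
          ← ENNReal.ofReal_mul (by positivity), ← ENNReal.ofReal_mul (by positivity)]
    _ ≤ _ := by
        apply ENNReal.ofReal_le_ofReal
        calc _ = b⁻¹ * (2 * (a / b) ^ (-(1 : ℝ) / 2)) * 4 * Real.exp (-x / (2 * b)) * c := by ring
          _ ≤ b⁻¹ * (2 * (a / b) ^ (-(1 : ℝ) / 2)) * 4 * Real.exp (-x / (2 * b)) *
            ((1 + a + b) / a * (1 + x)) := by gcongr
          _ = _ := by ring

/-- paper's Lemma 1. If `U, V` are independent centered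
chi-square random variables and `w ∈ (0, 1/√2]`, then `w·U + √(1−w²)·V` has a
density that eventually decays like `(1+x)·e^{−x/(2√(1−w²))}`. -/
theorem two_term_weighted_sum_density_decay
    {Ω : Type*} [MeasureSpace Ω] [IsProbabilityMeasure (ℙ : Measure Ω)]
    (U V : Ω → ℝ) (hUm : Measurable U) (hVm : Measurable V)
    (hindep : IndepFun U V ℙ)
    (hU : Measure.map U ℙ =
      volume.withDensity fun t => ENNReal.ofReal (centeredChiSqPDF t))
    (hV : Measure.map V ℙ =
      volume.withDensity fun t => ENNReal.ofReal (centeredChiSqPDF t))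
    (w : ℝ) (hw : w ∈ Set.Ioc (0 : ℝ) (1 / Real.sqrt 2)) :
    ∃ h : ℝ → ℝ,
      Measure.map (fun ω => w * U ω + Real.sqrt (1 - w ^ 2) * V ω) ℙ =
        volume.withDensity (fun x => ENNReal.ofReal (h x)) ∧
      ∃ C > (0 : ℝ), ∃ x₀ : ℝ, ∀ᵐ x ∂(volume : Measure ℝ), x₀ ≤ x →
        h x ≤ C * (1 + x) * Real.exp (-x / (2 * Real.sqrt (1 - w ^ 2))) := by

  obtain ⟨hw0, hw1⟩ := hw
  have hw2 : w ^ 2 ≤ 1 / 2 := by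
    have := pow_le_pow_left₀ hw0.le hw1 2
    rwa [div_pow, Real.sq_sqrt (by norm_num), one_pow] at this
  have hab : w ≤ Real.sqrt (1 - w ^ 2) := Real.le_sqrt_of_sq_le (by linarith)
  set b := Real.sqrt (1 - w ^ 2) with hbdef
  have hb : 0 < b := hw0.trans_le hab
  have hmap := aux_map U V hUm hVm hindep hU hV w b hb
  have hfin : ∀ᵐ x ∂(volume : Measure ℝ), auxH w b x < ⊤ := by
    apply ae_lt_top (auxH_meas w b)
    have : IsProbabilityMeasure (Measure.map (fun ω => w * U ω + b * V ω) ℙ) :=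
      Measure.isProbabilityMeasure_map (by fun_prop)
    have h1 := measure_lt_top (Measure.map (fun ω => w * U ω + b * V ω) ℙ) Set.univ
    rw [hmap, withDensity_apply _ MeasurableSet.univ, Measure.restrict_univ] at h1
    exact h1.ne
  refine ⟨fun x => (auxH w b x).toReal, ?_,
    b⁻¹ * (2 * (w / b) ^ (-(1 : ℝ) / 2)) * 4 * ((1 + w + b) / w), by positivity, 0, ?_⟩
  · rw [hmap]
    apply withDensity_congr_ae
    filter_upwards [hfin] with x hx
    rw [ENNReal.ofReal_toReal hx.ne]
  · refine Filter.Eventually.of_forall fun x hx => ?_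
    have hx1 : 0 < 1 + x := by linarith
    exact ENNReal.toReal_le_of_le_ofReal (by positivity) (aux_bound w b hw0 hab x hx)
end

section
/- For every integer m ≥ 2 there exists x₀ ∈ ℝ such that for all x ≥ x₀: (√m/(2^{m/2}·Γ(m/2)))·(√m·x + m)^{m/2−1}·e^{−(√m·x + m)/2} ≤ (1/√(2π))·(x+1)^{−1/2}·e^{−(x+1)/2}. -/
/-- The density of `(χ²_m − m)/√m` eventually lies below the
density of `χ²₁ − 1`: for every integer `m ≥ 2` there is `x₀` beyond which
`(√m/(2^{m/2}·Γ(m/2)))·(√m·x + m)^{m/2−1}·e^{−(√m·x+m)/2}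
  ≤ (1/√(2π))·(x+1)^{−1/2}·e^{−(x+1)/2}`. -/
theorem scaled_chisq_density_eventually_le (m : ℕ) (hm : 2 ≤ m) :
    ∃ x₀ : ℝ, ∀ x ≥ x₀,
      Real.sqrt m / ((2 : ℝ) ^ ((m : ℝ) / 2) * Real.Gamma ((m : ℝ) / 2)) *
          (Real.sqrt m * x + m) ^ ((m : ℝ) / 2 - 1) *
          Real.exp (-(Real.sqrt m * x + m) / 2) ≤
        (Real.sqrt (2 * Real.pi))⁻¹ * (x + 1) ^ (-(1 : ℝ) / 2) *
          Real.exp (-(x + 1) / 2) := by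
  have hm1 : (2 : ℝ) ≤ m := by exact_mod_cast hm
  set s : ℝ := Real.sqrt m with hs
  have hss : s * s = m := Real.mul_self_sqrt (by linarith)
  have hs0 : 0 ≤ s := Real.sqrt_nonneg _
  have hs1 : 1 < s := by nlinarith
  set C : ℝ := s / ((2 : ℝ) ^ ((m : ℝ) / 2) * Real.Gamma ((m : ℝ) / 2))
  set K : ℝ := (Real.sqrt (2 * Real.pi))⁻¹ with hK
  have hK0 : 0 < K := by positivity
  set a : ℝ := (m : ℝ) / 2 - 1
  have hb : 0 < (1 - s⁻¹) / 2 := by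
    have := inv_lt_one_of_one_lt₀ hs1
    linarith
  have h1 := (tendsto_rpow_mul_exp_neg_mul_atTop_nhds_zero (a + 1 / 2) _ hb).const_mul C
  rw [mul_zero] at h1
  have h2 := h1.eventually_le_const hK0
  obtain ⟨N, hN⟩ := Filter.eventually_atTop.1 h2
  refine ⟨max 0 N, fun x hx => ?_⟩
  have hx0 : 0 ≤ x := le_trans (le_max_left _ _) hx
  have hxN : N ≤ x := le_trans (le_max_right _ _) hx
  have hxs : x ≤ s * x := by nlinarith
  have h3 := hN (s * x + m) (by linarith)
  set y : ℝ := s * x + m with hy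
  have hy0 : 0 < y := by linarith
  have e1 : y ^ a = y ^ (a + 1 / 2) * y ^ (-(1 : ℝ) / 2) := by
    rw [← Real.rpow_add hy0]
    congr 1
    ring
  have hys : s⁻¹ * y = x + s := by
    rw [hy, ← hss]
    field_simp
  have e2 : Real.exp (-y / 2) = Real.exp (-((1 - s⁻¹) / 2) * y) * Real.exp (-(x + s) / 2) := by
    rw [← Real.exp_add, ← hys]
    congr 1
    ring
  have i1 : y ^ (-(1 : ℝ) / 2) ≤ (x + 1) ^ (-(1 : ℝ) / 2) :=
    Real.rpow_le_rpow_of_nonpos (by linarith) (by linarith) (by norm_num)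
  have i2 : Real.exp (-(x + s) / 2) ≤ Real.exp (-(x + 1) / 2) :=
    Real.exp_le_exp.2 (by linarith)
  have hp : 0 ≤ y ^ (-(1 : ℝ) / 2) := Real.rpow_nonneg hy0.le _
  calc C * y ^ a * Real.exp (-y / 2)
      = (C * (y ^ (a + 1 / 2) * Real.exp (-((1 - s⁻¹) / 2) * y))) * y ^ (-(1 : ℝ) / 2)
          * Real.exp (-(x + s) / 2) := by rw [e1, e2]; ring
    _ ≤ K * y ^ (-(1 : ℝ) / 2) * Real.exp (-(x + s) / 2) := by gcongr
    _ ≤ K * (x + 1) ^ (-(1 : ℝ) / 2) * Real.exp (-(x + 1) / 2) := by gcongr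
end

section
/- For every integer m ≥ 2, let μ_m be the pushforward of the Gamma distribution with shape m/2 and rate 1/2 under the map y ↦ (y − m)/√m, and let μ_U be the pushforward of the Gamma distribution with shape 1/2 and rate 1/2 under the map y ↦ y − 1. Then there exists x₀ ∈ ℝ such that for all x ≥ x₀, μ_m((x, ∞)) ≤ μ_U((x, ∞)). -/
open MeasureTheory ProbabilityTheory

lemma gamma_density_eventually (a s m : ℝ) (ha : 1 ≤ a) (hs : 1 < s) (hm : m = s ^ 2) :
    ∃ u₀ : ℝ, ∀ u ≥ u₀, s * gammaPDFReal a (1 / 2) (m + s * (u - 1)) ≤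
      gammaPDFReal (1 / 2) (1 / 2) u := by
  have hG : 0 < Real.Gamma a := Real.Gamma_pos_of_pos (by linarith)
  have hG' : 0 < Real.Gamma (1 / 2) := Real.Gamma_pos_of_pos (by norm_num)
  have hm0 : 0 < m := by rw [hm]; positivity
  have hs0 : 0 < s := by linarith
  set A : ℝ := s * ((1 / 2 : ℝ) ^ a / Real.Gamma a * m ^ (a - 1)) with hA
  set B : ℝ := (1 / 2 : ℝ) ^ (1 / 2 : ℝ) / Real.Gamma (1 / 2) with hB
  have hA0 : 0 < A := by positivity
  have hB0 : 0 < B := by positivity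
  have key := (isLittleO_rpow_exp_pos_mul_atTop (a - 1 / 2)
    (b := (s - 1) / 2) (by linarith)).bound (c := B / A) (by positivity)
  obtain ⟨u₀, hu₀⟩ := Filter.eventually_atTop.1 key
  refine ⟨max u₀ 1, fun u hu => ?_⟩
  have hu1 : 1 ≤ u := le_trans (le_max_right _ _) hu
  have hupos : 0 < u := by linarith
  have h := hu₀ u (le_trans (le_max_left _ _) hu)
  rw [Real.norm_of_nonneg (by positivity), Real.norm_of_nonneg (by positivity)] at h
  have hsm : s ≤ m := by rw [hm]; nlinarith
  have ht0 : 0 ≤ m + s * (u - 1) := by nlinarith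
  have htle : m + s * (u - 1) ≤ m * u := by nlinarith
  have h' : A * u ^ (a - 1 / 2) ≤ B * Real.exp ((s - 1) / 2 * u) := by
    rw [div_mul_eq_mul_div, le_div_iff₀ hA0] at h
    linarith
  rw [gammaPDFReal, gammaPDFReal, if_pos ht0, if_pos hupos.le]
  have h1 : (m + s * (u - 1)) ^ (a - 1) ≤ m ^ (a - 1) * u ^ (a - 1) := by
    rw [← Real.mul_rpow hm0.le hupos.le]
    exact Real.rpow_le_rpow ht0 htle (by linarith)
  have h2 : Real.exp (-(1 / 2 * (m + s * (u - 1)))) ≤ Real.exp (-(s * u / 2)) := by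
    apply Real.exp_le_exp.2; nlinarith
  have e1 : u ^ (a - 1) = u ^ (a - 1 / 2) * u ^ ((1 / 2 : ℝ) - 1) := by
    rw [← Real.rpow_add hupos]; congr 1; ring
  have e2 : Real.exp (-(1 / 2 * u)) = Real.exp ((s - 1) / 2 * u) * Real.exp (-(s * u / 2)) := by
    rw [← Real.exp_add]; congr 1; ring
  calc s * ((1 / 2 : ℝ) ^ a / Real.Gamma a * (m + s * (u - 1)) ^ (a - 1) *
        Real.exp (-(1 / 2 * (m + s * (u - 1)))))
      ≤ s * ((1 / 2 : ℝ) ^ a / Real.Gamma a * (m ^ (a - 1) * u ^ (a - 1)) *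
        Real.exp (-(s * u / 2))) := by gcongr
    _ = (A * u ^ (a - 1 / 2)) * (u ^ ((1 / 2 : ℝ) - 1) * Real.exp (-(s * u / 2))) := by
        rw [e1, hA]; ring
    _ ≤ (B * Real.exp ((s - 1) / 2 * u)) *
        (u ^ ((1 / 2 : ℝ) - 1) * Real.exp (-(s * u / 2))) := by gcongr
    _ = _ := by rw [e2, hB]; ring

/-- upper-tail dominance in the paper's Theorem 6.
`(χ²_m − m)/√m` is eventually dominated in the upper tail by `χ²₁ − 1`. -/
theorem scaled_chisq_upper_tail_dominated (m : ℕ) (hm : 2 ≤ m) :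
    ∃ x₀ : ℝ, ∀ x ≥ x₀,
      Measure.map (fun y => (y - m) / Real.sqrt m)
          (gammaMeasure ((m : ℝ) / 2) (1 / 2)) (Set.Ioi x) ≤
        Measure.map (fun y => y - 1) (gammaMeasure (1 / 2) (1 / 2))
          (Set.Ioi x) := by
  have hm2 : (2 : ℝ) ≤ m := by exact_mod_cast hm
  set s := Real.sqrt m with hs
  have hs2 : (m : ℝ) = s ^ 2 := (Real.sq_sqrt (by linarith)).symm
  have hs1 : 1 < s := by
    rw [hs]; apply Real.lt_sqrt_of_sq_lt; linarith
  have hs0 : 0 < s := by linarith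
  obtain ⟨u₀, hu₀⟩ := gamma_density_eventually ((m : ℝ) / 2) s m (by linarith) hs1 hs2
  refine ⟨u₀, fun x hx => ?_⟩
  rw [Measure.map_apply (by fun_prop) measurableSet_Ioi,
    Measure.map_apply (by fun_prop) measurableSet_Ioi]
  have i1 : (fun y : ℝ => (y - m) / s) ⁻¹' Set.Ioi x =
      (fun u : ℝ => m + s * (u - 1)) '' Set.Ioi (x + 1) := by
    ext y
    simp only [Set.mem_preimage, Set.mem_Ioi, Set.mem_image]
    constructor
    · intro h
      exact ⟨(y - m) / s + 1, by linarith, by field_simp; ring⟩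
    · rintro ⟨u, hu, rfl⟩
      rw [lt_div_iff₀ hs0]; nlinarith
  have i2 : (fun y : ℝ => y - 1) ⁻¹' Set.Ioi x = Set.Ioi (x + 1) := by
    ext y
    simp only [Set.mem_preimage, Set.mem_Ioi]
    constructor <;> intro h <;> linarith
  have hmeas := (by fun_prop : Measurable fun y : ℝ => (y - m) / s) (measurableSet_Ioi (a := x))
  rw [gammaMeasure, gammaMeasure, withDensity_apply _ hmeas, i1, i2,
    withDensity_apply _ measurableSet_Ioi,
    lintegral_image_eq_lintegral_abs_deriv_mul (f' := fun _ => s) measurableSet_Ioi]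
  · refine setLIntegral_mono' measurableSet_Ioi fun u hu => ?_
    rw [gammaPDF, gammaPDF, ← ENNReal.ofReal_mul (abs_nonneg _), abs_of_pos hs0]
    apply ENNReal.ofReal_le_ofReal
    have : x + 1 < u := hu
    exact hu₀ u (by linarith)
  · intro u _
    have := ((((hasDerivAt_id u).sub_const 1).const_mul s).const_add (m : ℝ))
    simpa using this.hasDerivWithinAt
  · intro u _ v _ h
    have h' : s * (u - 1) = s * (v - 1) := by simpa using h
    have := mul_left_cancel₀ hs0.ne' h'
    linarith
end
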